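/- Let W be a vector space over ℂ, let (a(x), b(x)) be a quasi compatible ordered pair in ℰ(W), and let α ∈ ℂˣ. Then: (1) a(x)_{(α,n)} b(x) ∈ ℰ(W) = Hom(W, W((x))) for all n ∈ ℤ. (2) If p(x₁,x₂) is a nonzero polynomial with p(x₁,x₂)a(x₁)b(x₂) ∈ Hom(W, W((x₁,x₂))) and k is an integer such that x₀^k ι_{x₂,x₀}(p(x₀+αx₂,x₂)⁻¹) ∈ ℂ((x₂))[[x₀]], then a(x)_{(α,n)} b(x) = 0 for all n ≥ k. (3) For each w ∈ W, if l is a nonnegative integer (depending on w) with x₁^l p(x₁,x₂)a(x₁)b(x₂)w ∈ W[[x₁,x₂]][x₂⁻¹], then (x₀+αx₂)^l p(x₀+αx₂,x₂)(Y_ℰ^{(α)}(a(x₂),x₀)b(x₂))w = (x₀+αx₂)^l p(x₀+αx₂,x₂) a(x₀+αx₂) b(x₂) w. -/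

import Mathlib

noncomputable section

open Classical

namespace NVA

/-! ### The space ℰ(W) = Hom(W, W((x))), coefficient-indexed by modes:
`a w n` is the mode `a_n` applied to `w`, where `a(x)w = ∑ (a_n w) x^{-n-1}`.
Lower truncation of `a(x)w` in powers of `x` means `a_n w = 0` for `n` large. -/

variable (W : Type*) [AddCommGroup W] [Module ℂ W]

/-- `ℰ(W) = Hom(W, W((x)))` as a submodule of `Hom(W, W[[x^{±1}]])`. -/
def EWsub : Submodule ℂ (W →ₗ[ℂ] (ℤ → W)) where
  carrier := {a | ∀ w : W, ∃ N : ℤ, ∀ n : ℤ, N ≤ n → a w n = 0}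
  add_mem' := by
    intro a b ha hb w
    obtain ⟨N, hN⟩ := ha w
    obtain ⟨M, hM⟩ := hb w
    refine ⟨max N M, fun n hn => ?_⟩
    simp only [LinearMap.add_apply, Pi.add_apply,
      hN n (le_trans (le_max_left _ _) hn), hM n (le_trans (le_max_right _ _) hn), add_zero]
  zero_mem' := by intro w; exact ⟨0, fun n _ => rfl⟩
  smul_mem' := by
    intro c a ha w
    obtain ⟨N, hN⟩ := ha w
    exact ⟨N, fun n hn => by
      simp only [LinearMap.smul_apply, Pi.smul_apply, hN n hn, smul_zero]⟩

/-- The type `ℰ(W)`. -/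
abbrev EW := ↥(EWsub W)

variable {W}

/-- The mode function of an element of `ℰ(W)`. -/
def mf (a : EW W) : W → ℤ → W := fun w n => (a : W →ₗ[ℂ] (ℤ → W)) w n

/-- The identity operator `1_W`, as an element of `ℰ(W)`. -/
def oneE : EW W :=
  ⟨{ toFun := fun w n => if n = -1 then w else 0
     map_add' := by
       intro w w'; funext n; by_cases h : n = -1 <;> simp [h]
     map_smul' := by
       intro c w; funext n; by_cases h : n = -1 <;> simp [h] },
   fun w => ⟨0, fun n hn => if_neg (by omega)⟩⟩

/-- The generalized binomial coefficient `C(m, j)` for `m ∈ ℤ`, as a complex number. -/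
def binom (m : ℤ) (j : ℕ) : ℂ :=
  (∏ i ∈ Finset.range j, ((m : ℂ) - (i : ℂ))) / (j.factorial : ℂ)

/-- The coefficient of `x₁^m x₂^t` in `a(x₁) b(x₂) w`. -/
def Fab (a b : EW W) (w : W) (m t : ℤ) : W := mf a (mf b w (-t - 1)) (-m - 1)

/-- Multiplication of a two-variable family by a polynomial `p(x₁,x₂)`. -/
def mulPoly (p : MvPolynomial (Fin 2) ℂ) (F : ℤ → ℤ → W) : ℤ → ℤ → W :=
  fun m t => ∑ d ∈ p.support, MvPolynomial.coeff d p • F (m - d 0) (t - d 1)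

/-- A two-variable family lies in `W((x₁,x₂))` (jointly lower truncated). -/
def IsLaurent2 (F : ℤ → ℤ → W) : Prop :=
  ∃ N : ℤ, ∀ m t : ℤ, (m < N ∨ t < N) → F m t = 0

/-- Quasi compatibility of an ordered pair `(a(x), b(x))` in `ℰ(W)`:
`p(x₁,x₂) a(x₁) b(x₂) ∈ Hom(W, W((x₁,x₂)))` for some nonzero polynomial `p`. -/
def QCPair (a b : EW W) : Prop :=
  ∃ p : MvPolynomial (Fin 2) ℂ, p ≠ 0 ∧ ∀ w, IsLaurent2 (mulPoly p (Fab a b w))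

/-! ### Sequences -/

/-- The coefficient of `x₁^{k 1} ⋯ x_r^{k r}` in `ψ₁(x₁) ⋯ ψ_r(x_r) w`. -/
def seqCoeff : {r : ℕ} → (Fin r → EW W) → W → (Fin r → ℤ) → W
  | 0, _, w, _ => w
  | _ + 1, ψ, w, k => mf (ψ 0) (seqCoeff (Fin.tail ψ) w (Fin.tail k)) (-(k 0) - 1)

/-- The polynomial `∏_{1 ≤ i < j ≤ r} p(x_i, x_j)`. -/
def pairPoly (p : MvPolynomial (Fin 2) ℂ) (r : ℕ) : MvPolynomial (Fin r) ℂ :=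
  ∏ ij ∈ Finset.univ.filter (fun ij : Fin r × Fin r => ij.1 < ij.2),
    MvPolynomial.rename ![ij.1, ij.2] p

/-- Multiplication of an `r`-variable family by a polynomial in `r` variables. -/
def mulPolyN {r : ℕ} (P : MvPolynomial (Fin r) ℂ) (F : (Fin r → ℤ) → W) :
    (Fin r → ℤ) → W :=
  fun k => ∑ d ∈ P.support, MvPolynomial.coeff d P • F (fun i => k i - d i)

/-- An `r`-variable family lies in `W((x₁,…,x_r))`. -/
def IsLaurentN {r : ℕ} (F : (Fin r → ℤ) → W) : Prop :=
  ∃ N : ℤ, ∀ k : Fin r → ℤ, (∃ i, k i < N) → F k = 0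

/-- Quasi compatibility of an ordered sequence in `ℰ(W)`. -/
def QCSeq {r : ℕ} (ψ : Fin r → EW W) : Prop :=
  ∃ p : MvPolynomial (Fin 2) ℂ, p ≠ 0 ∧
    ∀ w, IsLaurentN (mulPolyN (pairPoly p r) (seqCoeff ψ w))

/-- Quasi compatibility of a subset of `ℰ(W)`. -/
def QCSet (S : Set (EW W)) : Prop :=
  ∀ (r : ℕ) (ψ : Fin r → EW W), (∀ i, ψ i ∈ S) → QCSeq ψ

/-! ### The vertex operation `Y_ℰ^{(α)}` -/

/-- `ℂ((x))`. -/
abbrev LC : Type := LaurentSeries ℂ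

/-- An iterated Laurent series field, e.g. `ℂ((x))((x₀))` (outer variable the second one). -/
abbrev K2 : Type := HahnSeries ℤ LC

/-- The outer variable of `K2`. -/
def xOuter : K2 := HahnSeries.single 1 1

/-- The inner variable of `K2`. -/
def xInner : K2 := HahnSeries.single 0 (HahnSeries.single 1 1)

/-- `α` times the inner variable of `K2`. -/
def xInnerC (c : ℂ) : K2 := HahnSeries.single 0 (HahnSeries.single 1 c)

/-- The polynomial `p(x₀ + α x, x)` as an element of `ℂ((x))((x₀))`
(outer variable `x₀`). -/
def qK (p : MvPolynomial (Fin 2) ℂ) (α : ℂ) : K2 :=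
  MvPolynomial.aeval ![xOuter + xInnerC α, xInner] p

/-- The expansion `ι_{x,x₀} (p(x₀ + α x, x)^{-1}) ∈ ℂ((x))((x₀))`. -/
def qInv (p : MvPolynomial (Fin 2) ℂ) (α : ℂ) : K2 := (qK p α)⁻¹

/-- The coefficient of `x₀^j x^t` in `(p(x₁,x) a(x₁) b(x) w)|_{x₁ = αx + x₀}`,
expanding via `(αx+x₀)^m = ∑_{j≥0} C(m,j) α^{m-j} x^{m-j} x₀^j`. -/
def substYE (α : ℂ) (p : MvPolynomial (Fin 2) ℂ) (a b : EW W) (w : W)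
    (j : ℕ) (t : ℤ) : W :=
  ∑ᶠ m : ℤ, (binom m j * α ^ (m - (j : ℤ))) • mulPoly p (Fab a b w) m (t - m + j)

/-- The coefficient of `x₀^J x^T` in
`ι_{x,x₀}(p(x₀+αx,x)^{-1}) ⬝ (p(x₁,x)a(x₁)b(x)w)|_{x₁ = αx+x₀}`. -/
def fullYE (α : ℂ) (p : MvPolynomial (Fin 2) ℂ) (a b : EW W) (w : W)
    (J T : ℤ) : W :=
  ∑ᶠ s : ℤ × ℤ, (((qInv p α).coeff s.1).coeff s.2) •
    (if 0 ≤ J - s.1 then substYE α p a b w (J - s.1).toNat (T - s.2) else 0)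

/-- The raw mode family of `Y_ℰ^{(α)}(a(x), x₀) b(x)`; `rawYE α a b n w m` is the mode
`m` of the element `a(x)_{(α,n)} b(x)` applied to `w`.  (Defined using a choice of
polynomial from quasi compatibility; by the general theory the value does not depend
on the choice.) -/
def rawYE (α : ℂ) (a b : EW W) (n : ℤ) (w : W) (m : ℤ) : W :=
  if h : QCPair a b then fullYE α h.choose a b w (-n - 1) (-m - 1) else 0

/-- `a(x)_{(α,n)} b(x)`, as an element of `ℰ(W)` whenever the raw family is realized
by one (which is the case for any quasi compatible pair). -/
def YEa (α : ℂˣ) (a b : EW W) (n : ℤ) : EW W :=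
  if h : ∃ c : EW W, ∀ w m, mf c w m = rawYE (α : ℂ) a b n w m then h.choose else 0

/-- `a(x)_n b(x) = a(x)_{(1,n)} b(x)`. -/
def YE (a b : EW W) (n : ℤ) : EW W := YEa 1 a b n

end NVA

namespace NVA

variable {W : Type*} [AddCommGroup W] [Module ℂ W]

/-- Multiplication of a two-variable family (in `x₀, x₂`) by `g(x₀ + αx₂, x₂)` for a
polynomial `g`, expanding `(x₀+αx₂)^d` in nonnegative powers of `x₂`. -/
def mulSubPolyA (α : ℂ) (g : MvPolynomial (Fin 2) ℂ) (A : ℤ → ℤ → W) (a b : ℤ) : W :=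
  ∑ d ∈ g.support, ∑ i ∈ Finset.range (d 0 + 1),
    (MvPolynomial.coeff d g * ((d 0).choose i : ℂ) * α ^ i) •
      A (a - ((d 0 : ℤ) - i)) (b - (i : ℤ) - (d 1 : ℤ))

/-- The coefficient of `x₀^j x₂^t` in `a(x₀ + αx₂) b(x₂) w`, where negative powers
`(x₀+αx₂)^m` are expanded in nonnegative powers of `x₂`. -/
def substExp (α : ℂ) (a b : EW W) (w : W) (j t : ℤ) : W :=
  ∑ᶠ i : ℕ, (binom (j + i) i * α ^ i) • Fab a b w (j + i) (t - i)

/-! ### Two-variable families and shift operators -/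

/-- Multiplication of a two-variable family by the first variable. -/
def shiftFst : Module.End ℂ (ℤ → ℤ → W) where
  toFun A := fun j t => A (j - 1) t
  map_add' _ _ := rfl
  map_smul' _ _ := rfl

/-- Multiplication of a two-variable family by the second variable. -/
def shiftSnd : Module.End ℂ (ℤ → ℤ → W) where
  toFun A := fun j t => A j (t - 1)
  map_add' _ _ := rfl
  map_smul' _ _ := rfl

@[simp] lemma shiftFst_apply (A : ℤ → ℤ → W) (j t : ℤ) : shiftFst A j t = A (j - 1) t := rfl

@[simp] lemma shiftSnd_apply (A : ℤ → ℤ → W) (j t : ℤ) : shiftSnd A j t = A j (t - 1) := rfl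

lemma shiftFst_pow_apply (n : ℕ) (A : ℤ → ℤ → W) (j t : ℤ) :
    (shiftFst ^ n) A j t = A (j - n) t := by
  induction n generalizing j with
  | zero => simp
  | succ n ih =>
    rw [pow_succ', Module.End.mul_apply, shiftFst_apply, ih]
    congr 1; push_cast; ring

lemma shiftSnd_pow_apply (n : ℕ) (A : ℤ → ℤ → W) (j t : ℤ) :
    (shiftSnd ^ n) A j t = A j (t - n) := by
  induction n generalizing t with
  | zero => simp
  | succ n ih =>
    rw [pow_succ', Module.End.mul_apply, shiftSnd_apply, ih]
    congr 1; push_cast; ring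

lemma commute_shiftFst_shiftSnd :
    Commute (shiftFst : Module.End ℂ (ℤ → ℤ → W)) shiftSnd := rfl

/-- The value `p(A, B)` of a polynomial at an ordered pair of endomorphisms. -/
def evalEnd {V : Type*} [AddCommGroup V] [Module ℂ V] (A B : Module.End ℂ V)
    (p : MvPolynomial (Fin 2) ℂ) : Module.End ℂ V :=
  ∑ d ∈ p.support, MvPolynomial.coeff d p • (A ^ d 0 * B ^ d 1)

lemma commute_evalEnd {V : Type*} [AddCommGroup V] [Module ℂ V] {A B : Module.End ℂ V}
    (h : Commute A B) (p q : MvPolynomial (Fin 2) ℂ) :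
    Commute (evalEnd A B p) (evalEnd A B q) := by
  refine Commute.sum_left _ _ _ fun d _ => Commute.sum_right _ _ _ fun e _ => ?_
  refine Commute.smul_left (Commute.smul_right ?_ _) _
  exact Commute.mul_left
    (Commute.mul_right (Commute.pow_pow_self A _ _) (h.pow_pow _ _))
    (Commute.mul_right (h.symm.pow_pow _ _) (Commute.pow_pow_self B _ _))

/-- A map that is linear on an invariant submodule and intertwines two pairs of endomorphisms
there intertwines the values of any polynomial at these pairs. -/
lemma map_evalEnd {V V' : Type*} [AddCommGroup V] [Module ℂ V] [AddCommGroup V'] [Module ℂ V']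
    {A B : Module.End ℂ V} {A' B' : Module.End ℂ V'} (P : Submodule ℂ V) (φ : P →ₗ[ℂ] V')
    (hA : ∀ v ∈ P, A v ∈ P) (hB : ∀ v ∈ P, B v ∈ P)
    (hφA : ∀ v (hv : v ∈ P), φ ⟨A v, hA v hv⟩ = A' (φ ⟨v, hv⟩))
    (hφB : ∀ v (hv : v ∈ P), φ ⟨B v, hB v hv⟩ = B' (φ ⟨v, hv⟩))
    (p : MvPolynomial (Fin 2) ℂ) (v : V) (hv : v ∈ P) :
    ∃ h : evalEnd A B p v ∈ P, φ ⟨evalEnd A B p v, h⟩ = evalEnd A' B' p (φ ⟨v, hv⟩) := by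
  have hApow : ∀ (n : ℕ) (v : V) (hv : v ∈ P),
      ∃ h : (A ^ n) v ∈ P, φ ⟨(A ^ n) v, h⟩ = (A' ^ n) (φ ⟨v, hv⟩) := by
    intro n
    induction n with
    | zero => intro v hv; exact ⟨by simpa using hv, by simp⟩
    | succ n ih =>
      intro v hv
      obtain ⟨h, e⟩ := ih v hv
      simp only [pow_succ', Module.End.mul_apply]
      exact ⟨hA _ h, by rw [hφA _ h, e]⟩
  have hBpow : ∀ (n : ℕ) (v : V) (hv : v ∈ P),
      ∃ h : (B ^ n) v ∈ P, φ ⟨(B ^ n) v, h⟩ = (B' ^ n) (φ ⟨v, hv⟩) := by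
    intro n
    induction n with
    | zero => intro v hv; exact ⟨by simpa using hv, by simp⟩
    | succ n ih =>
      intro v hv
      obtain ⟨h, e⟩ := ih v hv
      simp only [pow_succ', Module.End.mul_apply]
      exact ⟨hB _ h, by rw [hφB _ h, e]⟩
  have hmon : ∀ d : Fin 2 →₀ ℕ, ∃ h : (A ^ d 0 * B ^ d 1) v ∈ P,
      φ ⟨(A ^ d 0 * B ^ d 1) v, h⟩ = (A' ^ d 0 * B' ^ d 1) (φ ⟨v, hv⟩) := by
    intro d
    obtain ⟨h₁, e₁⟩ := hBpow (d 1) v hv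
    obtain ⟨h₂, e₂⟩ := hApow (d 0) _ h₁
    exact ⟨h₂, by simp only [Module.End.mul_apply]; rw [e₂, e₁]⟩
  choose hmem hval using hmon
  have key : evalEnd A B p v =
      ((∑ d ∈ p.support, MvPolynomial.coeff d p • (⟨_, hmem d⟩ : P) : P) : V) := by
    simp [evalEnd, LinearMap.sum_apply]
  refine ⟨by rw [key]; exact Subtype.property _, ?_⟩
  have : (⟨evalEnd A B p v, by rw [key]; exact Subtype.property _⟩ : P) =
      ∑ d ∈ p.support, MvPolynomial.coeff d p • (⟨_, hmem d⟩ : P) := Subtype.ext key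
  rw [this, map_sum]
  simp only [map_smul, hval, evalEnd, LinearMap.sum_apply, LinearMap.smul_apply]

lemma mulPoly_eq_evalEnd (p : MvPolynomial (Fin 2) ℂ) (F : ℤ → ℤ → W) :
    mulPoly p F = evalEnd shiftFst shiftSnd p F := by
  funext m t
  simp only [mulPoly, evalEnd, LinearMap.sum_apply, LinearMap.smul_apply, Finset.sum_apply,
    Pi.smul_apply, Module.End.mul_apply, shiftFst_pow_apply, shiftSnd_pow_apply]

lemma mulPoly_comm (p q : MvPolynomial (Fin 2) ℂ) (F : ℤ → ℤ → W) :
    mulPoly p (mulPoly q F) = mulPoly q (mulPoly p F) := by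
  simp only [mulPoly_eq_evalEnd]
  exact LinearMap.congr_fun (commute_evalEnd commute_shiftFst_shiftSnd p q).eq F

lemma mulSubPolyA_eq_evalEnd (α : ℂ) (g : MvPolynomial (Fin 2) ℂ) (A : ℤ → ℤ → W) :
    mulSubPolyA α g A = evalEnd (shiftFst + α • shiftSnd) shiftSnd g A := by
  funext m t
  simp only [mulSubPolyA, evalEnd, LinearMap.sum_apply, LinearMap.smul_apply, Finset.sum_apply,
    Pi.smul_apply]
  refine Finset.sum_congr rfl fun d _ => ?_
  have hc : Commute (α • shiftSnd : Module.End ℂ (ℤ → ℤ → W)) shiftFst :=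
    (commute_shiftFst_shiftSnd.symm).smul_left α
  rw [add_comm shiftFst, hc.add_pow]
  simp only [Module.End.mul_apply, LinearMap.sum_apply, Finset.sum_apply, Finset.smul_sum]
  refine Finset.sum_congr rfl fun i hi => ?_
  have hi' : i ≤ d 0 := by simpa [Nat.lt_succ_iff] using hi
  rw [smul_pow]
  simp only [LinearMap.smul_apply, Pi.smul_apply, Module.End.natCast_apply, map_nsmul,
    shiftFst_pow_apply, shiftSnd_pow_apply]
  rw [← Nat.cast_smul_eq_nsmul ℂ, smul_smul, smul_smul, Nat.cast_sub hi']

/-! ### Binomial coefficients -/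

lemma binom_zero_right (m : ℤ) : binom m 0 = 1 := by simp [binom]

lemma binom_succ (m : ℤ) (j : ℕ) :
    binom (m + 1) (j + 1) = binom m (j + 1) + binom m j := by
  have h₁ : (j.factorial : ℂ) ≠ 0 := Nat.cast_ne_zero.mpr j.factorial_ne_zero
  have h₂ : (j : ℂ) + 1 ≠ 0 := Nat.cast_add_one_ne_zero j
  simp only [binom]
  rw [Finset.prod_range_succ', Finset.prod_range_succ (fun i : ℕ => ((m : ℂ) - i)),
    Nat.factorial_succ]
  have h₃ : ∀ i : ℕ, (((m + 1 : ℤ) : ℂ) - ((i + 1 : ℕ) : ℂ)) = (m : ℂ) - i := by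
    intro i; push_cast; ring
  simp only [h₃]
  push_cast
  field_simp
  ring

lemma binom_natCast (n j : ℕ) : binom (n : ℤ) j = (n.choose j : ℂ) := by
  induction n generalizing j with
  | zero =>
    cases j with
    | zero => simp [binom]
    | succ j => simp [binom, Finset.prod_range_succ']
  | succ n ih =>
    cases j with
    | zero => simp [binom]
    | succ j =>
      rw [Nat.choose_succ_succ, Nat.cast_succ, binom_succ, ih, ih]
      push_cast; ring

/-- The binomial coefficient `C(m, j)`, extended by zero to negative `j`. -/
def binomZ (m j : ℤ) : ℂ := if 0 ≤ j then binom m j.toNat else 0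

lemma binomZ_of_neg (m : ℤ) {j : ℤ} (hj : j < 0) : binomZ m j = 0 := if_neg (by omega)

lemma binomZ_natCast (m : ℤ) (j : ℕ) : binomZ m j = binom m j := by simp [binomZ]

lemma binomZ_succ (m j : ℤ) : binomZ (m + 1) j = binomZ m j + binomZ m (j - 1) := by
  rcases lt_trichotomy j 0 with hj | rfl | hj
  · rw [binomZ_of_neg _ hj, binomZ_of_neg _ hj, binomZ_of_neg _ (by omega), add_zero]
  · rw [binomZ_of_neg m (show (0 : ℤ) - 1 < 0 by omega)]
    simp [binomZ, binom_zero_right]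
  · obtain ⟨k, rfl⟩ : ∃ k : ℕ, j = (k + 1 : ℕ) := ⟨(j - 1).toNat, by omega⟩
    rw [binomZ_natCast, binomZ_natCast, binom_succ,
      show ((k + 1 : ℕ) : ℤ) - 1 = k by push_cast; ring, binomZ_natCast]

lemma binomZ_symm {m : ℤ} (hm : 0 ≤ m) (j : ℤ) : binomZ m (m - j) = binomZ m j := by
  obtain ⟨n, rfl⟩ := Int.eq_ofNat_of_zero_le hm
  rcases lt_or_ge j 0 with hj | hj
  · obtain ⟨i, hi⟩ : ∃ i : ℕ, (n : ℤ) - j = i := ⟨(n - j).toNat, by omega⟩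
    rw [binomZ_of_neg _ hj, hi, binomZ_natCast, binom_natCast, Nat.choose_eq_zero_of_lt (by omega),
      Nat.cast_zero]
  · obtain ⟨k, rfl⟩ := Int.eq_ofNat_of_zero_le hj
    rcases lt_or_ge n k with hk | hk
    · rw [binomZ_of_neg _ (by omega), binomZ_natCast, binom_natCast, Nat.choose_eq_zero_of_lt hk,
        Nat.cast_zero]
    · rw [← Nat.cast_sub hk, binomZ_natCast, binomZ_natCast, binom_natCast, binom_natCast,
        Nat.choose_symm hk]

/-! ### Substitution of a binomial into a two-variable family -/

/-- The families into which `x₁^m = ∑_j κ(m, j) α^{m-j} x₀^j x₂^{m-j}` can be substituted. -/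
def substDomain (κ : ℤ → ℤ → ℂ) : Submodule ℂ (ℤ → ℤ → W) where
  carrier := {G | ∀ j t, (Function.support fun m => κ m j • G m (t - m + j)).Finite}
  add_mem' {G H} hG hH j t := by
    refine ((hG j t).union (hH j t)).subset fun m hm => ?_
    simp only [Set.mem_union, Function.mem_support, Pi.add_apply, smul_add] at hm ⊢
    by_contra! h
    exact hm (by rw [h.1, h.2, add_zero])
  zero_mem' j t := by simp
  smul_mem' c G hG j t := by
    refine (hG j t).subset fun m hm => ?_
    simp only [Function.mem_support, Pi.smul_apply] at hm ⊢
    intro h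
    exact hm (by rw [smul_comm, h, smul_zero])

/-- The family obtained by substituting `x₁^m = ∑_j κ(m, j) α^{m-j} x₀^j x₂^{m-j}`. -/
def substFamily (α : ℂ) (κ : ℤ → ℤ → ℂ) (G : ℤ → ℤ → W) : ℤ → ℤ → W :=
  fun j t => ∑ᶠ m : ℤ, (κ m j * α ^ (m - j)) • G m (t - m + j)

lemma finite_support_of_mem_substDomain {κ : ℤ → ℤ → ℂ} {G : ℤ → ℤ → W}
    (hG : G ∈ substDomain κ) (f : ℤ → ℂ) (j t : ℤ) :
    (Function.support fun m => (κ m j * f m) • G m (t - m + j)).Finite := by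
  refine (hG j t).subset fun m hm => ?_
  simp only [Function.mem_support] at hm ⊢
  intro h
  exact hm (by rw [mul_comm, mul_smul, h, smul_zero])

/-- `substFamily` as a linear map on its domain. -/
def substLinear (α : ℂ) (κ : ℤ → ℤ → ℂ) :
    (substDomain κ : Submodule ℂ (ℤ → ℤ → W)) →ₗ[ℂ] (ℤ → ℤ → W) where
  toFun G := substFamily α κ G
  map_add' G H := by
    funext j t
    simp only [substFamily, Submodule.coe_add, Pi.add_apply, smul_add]
    exact finsum_add_distrib (finite_support_of_mem_substDomain G.2 _ j t)
      (finite_support_of_mem_substDomain H.2 _ j t)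
  map_smul' c G := by
    funext j t
    simp only [substFamily, Submodule.coe_smul, Pi.smul_apply, RingHom.id_apply, smul_finsum]
    exact finsum_congr fun m => smul_comm _ _ _

/-- Substitution turns multiplication by `p(x₁, x₂)` into multiplication by
`p(x₀ + αx₂, x₂)`. -/
lemma substFamily_mulPoly {α : ℂ} (hα : α ≠ 0) {κ : ℤ → ℤ → ℂ}
    (hκ : ∀ m j, κ (m + 1) j = κ m j + κ m (j - 1))
    (p : MvPolynomial (Fin 2) ℂ) {G : ℤ → ℤ → W} (hG : G ∈ substDomain κ) :
    substFamily α κ (mulPoly p G) = mulSubPolyA α p (substFamily α κ G) := by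
  rw [mulPoly_eq_evalEnd, mulSubPolyA_eq_evalEnd]
  have hfst : ∀ H ∈ (substDomain κ : Submodule ℂ (ℤ → ℤ → W)), shiftFst H ∈ substDomain κ := by
    intro H hH j t
    refine (((hH j (t - 1)).union (hH (j - 1) t)).image (· + 1)).subset fun m hm => ?_
    refine ⟨m - 1, ?_, by simp⟩
    simp only [Set.mem_union, Function.mem_support, shiftFst_apply] at hm ⊢
    by_contra! h
    apply hm
    have := hκ (m - 1) j
    rw [sub_add_cancel] at this
    rw [this, add_smul]
    convert congrArg₂ (· + ·) h.1 h.2 using 1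
    · congr 3 <;> ring_nf
    · simp
  have hsnd : ∀ H ∈ (substDomain κ : Submodule ℂ (ℤ → ℤ → W)), shiftSnd H ∈ substDomain κ := by
    intro H hH j t
    convert hH j (t - 1) using 4 with m
    simp only [shiftSnd_apply]
    congr 1; ring
  refine (map_evalEnd (substDomain κ) (substLinear α κ) hfst hsnd ?_ ?_ p G hG).2
  · intro H hH
    funext j t
    change substFamily α κ (shiftFst H) j t =
      substFamily α κ H (j - 1) t + α • substFamily α κ H j (t - 1)
    simp only [substFamily, smul_finsum, smul_smul]
    rw [← finsum_add_distrib (finite_support_of_mem_substDomain hH _ _ _)]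
    · rw [← finsum_comp_equiv (Equiv.addRight (1 : ℤ))]
      refine finsum_congr fun m => ?_
      simp only [Equiv.coe_addRight, shiftFst_apply, hκ, add_sub_cancel_right]
      rw [show t - m + (j - 1) = t - (m + 1) + j by ring,
        show t - 1 - m + j = t - (m + 1) + j by ring, ← add_smul]
      congr 1
      rw [show m - (j - 1) = m + 1 - j by ring, show m + 1 - j = (m - j) + 1 by ring,
        zpow_add_one₀ hα]
      ring
    · refine (finite_support_of_mem_substDomain hH (fun m => α * α ^ (m - j)) j (t - 1)).subset
        fun m hm => ?_
      rwa [Function.mem_support, mul_left_comm] at hm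
  · intro H hH
    funext j t
    change substFamily α κ (shiftSnd H) j t = substFamily α κ H j (t - 1)
    refine finsum_congr fun m => ?_
    simp only [shiftSnd_apply]
    congr 2; ring

lemma IsLaurent2.mem_substDomain {G : ℤ → ℤ → W} (hG : IsLaurent2 G) (κ : ℤ → ℤ → ℂ) :
    G ∈ substDomain κ := by
  obtain ⟨N, hN⟩ := hG
  intro j t
  refine (Set.finite_Icc N (t + j - N)).subset fun m hm => ?_
  by_contra h
  rw [Set.mem_Icc, not_and_or] at h
  exact hm (by simp only; rw [hN _ _ (by omega), smul_zero])

lemma mf_add (a : EW W) (w w' : W) (n : ℤ) : mf a (w + w') n = mf a w n + mf a w' n := by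
  simp [mf]

lemma mf_smul (a : EW W) (c : ℂ) (w : W) (n : ℤ) : mf a (c • w) n = c • mf a w n := by
  simp [mf]

lemma mf_zero (a : EW W) (n : ℤ) : mf a 0 n = 0 := by
  simp [mf]

lemma Fab_add (a b : EW W) (w w' : W) : Fab a b (w + w') = Fab a b w + Fab a b w' := by
  funext m t; simp [Fab, mf_add]

lemma Fab_smul (a b : EW W) (c : ℂ) (w : W) : Fab a b (c • w) = c • Fab a b w := by
  funext m t; simp [Fab, mf_smul]

lemma Fab_mem_substDomain (a b : EW W) (w : W) :
    Fab a b w ∈ substDomain fun m j => binomZ m (m - j) := by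
  obtain ⟨N, hN⟩ := b.2 w
  intro j t
  refine (Set.finite_Icc j (t + j + N)).subset fun m hm => ?_
  by_contra h
  rw [Set.mem_Icc, not_and_or] at h
  apply hm
  rcases h with h | h
  · simp only [binomZ_of_neg m (show m - j < 0 by omega), zero_smul]
  · have : mf b w (-(t - m + j) - 1) = 0 := hN _ (by omega)
    simp only [Fab, this, mf_zero, smul_zero]

lemma substExp_eq_substFamily (α : ℂ) (a b : EW W) (w : W) :
    substExp α a b w = substFamily α (fun m j => binomZ m (m - j)) (Fab a b w) := by
  funext j t
  simp only [substExp, substFamily]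
  have hinj : Function.Injective fun i : ℕ => j + (i : ℤ) := fun x y h => by simpa using h
  rw [← Set.indicator_eq_self (f := fun m : ℤ => (binomZ m (m - j) * α ^ (m - j)) •
      Fab a b w m (t - m + j)) (s := Set.range fun i : ℕ => j + (i : ℤ)) |>.2,
    ← finsum_mem_def, finsum_mem_range hinj]
  · refine finsum_congr fun i => ?_
    simp only [add_sub_cancel_left, binomZ_natCast, zpow_natCast]
    congr 2; ring
  · intro m hm
    rcases lt_or_ge (m - j) 0 with h | h
    · exact absurd (by simp only [binomZ_of_neg m h, zero_mul, zero_smul]) hm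
    · exact ⟨(m - j).toNat, by simp only; omega⟩

lemma substFamily_binomZ_symm (α : ℂ) {G : ℤ → ℤ → W} (hG : ∀ m t, m < 0 → G m t = 0) :
    substFamily α (fun m j => binomZ m (m - j)) G = substFamily α binomZ G := by
  funext j t
  refine finsum_congr fun m => ?_
  rcases lt_or_ge m 0 with hm | hm
  · simp only [hG _ _ hm, smul_zero]
  · simp only [binomZ_symm hm]

/-! ### The vector space `W((x))((x₀))` over `ℂ((x))((x₀))` -/

variable (W) in
/-- `W((x))((x₀))`, a vector space over `ℂ((x))((x₀))`. -/
def IterLaurent : Type _ := HahnModule ℤ LC (HahnModule ℤ ℂ W)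

instance : AddCommGroup (IterLaurent W) :=
  inferInstanceAs (AddCommGroup (HahnModule ℤ LC (HahnModule ℤ ℂ W)))

instance : Module K2 (IterLaurent W) :=
  inferInstanceAs (Module K2 (HahnModule ℤ LC (HahnModule ℤ ℂ W)))

/-- The coefficient of `x₀^j x^t` in an element of `W((x))((x₀))`. -/
def iterCoeff (v : IterLaurent W) : ℤ → ℤ → W :=
  fun j t => ((HahnModule.of ℂ).symm (((HahnModule.of LC).symm v).coeff j)).coeff t

lemma iterCoeff_injective : Function.Injective (iterCoeff : IterLaurent W → ℤ → ℤ → W) := by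
  intro v v' h
  refine HahnModule.ext _ _ (funext fun j => HahnModule.ext _ _ (funext fun t => ?_))
  exact congrFun (congrFun h j) t

lemma iterCoeff_add (v v' : IterLaurent W) :
    iterCoeff (v + v') = iterCoeff v + iterCoeff v' := rfl

lemma exists_iterCoeff_eq (A : ℤ → ℤ → W) (hA : ∃ N, ∀ j < N, ∀ t, A j t = 0)
    (hA' : ∀ j, ∃ N, ∀ t < N, A j t = 0) : ∃ v : IterLaurent W, iterCoeff v = A := by
  have h₁ : ∀ j, BddBelow (Function.support (A j)) := by
    intro j
    obtain ⟨N, hN⟩ := hA' j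
    exact ⟨N, fun t ht => not_lt.mp fun h => ht (hN t h)⟩
  let f : ℤ → HahnModule ℤ ℂ W := fun j => HahnModule.of ℂ (HahnSeries.ofSuppBddBelow (A j) (h₁ j))
  have h₂ : BddBelow (Function.support f) := by
    obtain ⟨N, hN⟩ := hA
    refine ⟨N, fun j hj => not_lt.mp fun h => hj ?_⟩
    exact HahnModule.ext _ _ (funext fun t => hN j h t)
  exact ⟨HahnModule.of LC (HahnSeries.ofSuppBddBelow f h₂), rfl⟩

lemma iterCoeff_lt (v : IterLaurent W) (j : ℤ) : ∃ N, ∀ t < N, iterCoeff v j t = 0 :=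
  ⟨_, fun _ ht => HahnSeries.coeff_eq_zero_of_lt_order ht⟩

lemma coeff_single_smul {R V : Type*} [MulZeroClass R] [AddCommMonoid V] [SMulWithZero R V]
    (b : ℤ) (r : R) (x : HahnModule ℤ R V) (a : ℤ) :
    ((HahnModule.of R).symm (HahnSeries.single b r • x)).coeff a =
      r • ((HahnModule.of R).symm x).coeff (a - b) := by
  have := HahnModule.coeff_single_smul_vadd (r := r) (x := x) (a := a - b) (b := b)
  rwa [vadd_eq_add, add_sub_cancel] at this

lemma iterCoeff_single_smul (i s : ℤ) (c : ℂ) (v : IterLaurent W) (j t : ℤ) :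
    iterCoeff ((HahnSeries.single i (HahnSeries.single s c : LC) : K2) • v) j t =
      c • iterCoeff v (j - i) (t - s) := by
  have h := coeff_single_smul i (HahnSeries.single s c : LC)
    (v : HahnModule ℤ LC (HahnModule ℤ ℂ W)) j
  refine (congrArg (fun u => ((HahnModule.of ℂ).symm u).coeff t) h).trans ?_
  exact coeff_single_smul s c _ t

lemma iterCoeff_xOuter_smul (v : IterLaurent W) :
    iterCoeff (xOuter • v) = shiftFst (iterCoeff v) := by
  funext j t
  have := iterCoeff_single_smul 1 0 1 v j t
  simpa [xOuter] using this

lemma iterCoeff_xInner_smul (v : IterLaurent W) :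
    iterCoeff (xInner • v) = shiftSnd (iterCoeff v) := by
  funext j t
  have := iterCoeff_single_smul 0 1 1 v j t
  simpa [xInner] using this

lemma iterCoeff_xInnerC_smul (c : ℂ) (v : IterLaurent W) :
    iterCoeff (xInnerC c • v) = c • shiftSnd (iterCoeff v) := by
  funext j t
  have := iterCoeff_single_smul 0 1 c v j t
  simpa [xInnerC] using this

/-- A complex number as an element of a commutative algebra. -/
abbrev scalarIn (K : Type*) [CommSemiring K] [Algebra ℂ K] (c : ℂ) : K := algebraMap ℂ K c

lemma scalarIn_K2 (c : ℂ) : scalarIn K2 c = HahnSeries.single 0 (HahnSeries.single 0 c : LC) := by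
  have h : ∀ c : ℂ, scalarIn LC c = HahnSeries.single 0 c := fun c =>
    (congrArg (HahnSeries.ofPowerSeries ℤ ℂ) (PowerSeries.algebraMap_apply (A := ℂ))).trans
      (HahnSeries.ofPowerSeries_C (Γ := ℤ) c)
  refine ((congrArg (HahnSeries.ofPowerSeries ℤ LC) (PowerSeries.algebraMap_apply (A := LC))).trans
      (HahnSeries.ofPowerSeries_C (Γ := ℤ) _)).trans ?_
  exact congrArg (HahnSeries.single 0) (h c)

section AbstractModule

variable {K M V : Type*} [CommSemiring K] [AddCommGroup M] [Module K M]
  [AddCommGroup V] [Module ℂ V] (coef : M →+ V)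

lemma map_pow_smul {z : K} {S : Module.End ℂ V} (h : ∀ v, coef (z • v) = S (coef v))
    (n : ℕ) (v : M) : coef (z ^ n • v) = (S ^ n) (coef v) := by
  induction n with
  | zero => simp
  | succ n ih => rw [pow_succ', mul_smul, h, ih, pow_succ', Module.End.mul_apply]

variable [Algebra ℂ K]

lemma map_aeval_smul (hc : ∀ (c : ℂ) v, coef (scalarIn K c • v) = c • coef v)
    {z z' : K} {S S' : Module.End ℂ V} (h : ∀ v, coef (z • v) = S (coef v))
    (h' : ∀ v, coef (z' • v) = S' (coef v)) (p : MvPolynomial (Fin 2) ℂ) (v : M) :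
    coef (MvPolynomial.aeval ![z, z'] p • v) = evalEnd S S' p (coef v) := by
  rw [MvPolynomial.aeval_def, MvPolynomial.eval₂_eq', Finset.sum_smul, map_sum, evalEnd,
    LinearMap.sum_apply]
  refine Finset.sum_congr rfl fun d _ => ?_
  rw [mul_smul, hc, Fin.prod_univ_two, mul_smul]
  simp only [Matrix.cons_val_zero, Matrix.cons_val_one, LinearMap.smul_apply,
    Module.End.mul_apply, map_pow_smul coef h, map_pow_smul coef h']

lemma aeval_eq_sum (z z' : K) (p : MvPolynomial (Fin 2) ℂ) :
    MvPolynomial.aeval ![z, z'] p =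
      ∑ d ∈ p.support, scalarIn K (p.coeff d) * (z ^ d 0 * z' ^ d 1) := by
  rw [MvPolynomial.aeval_def, MvPolynomial.eval₂_eq']
  simp [Fin.prod_univ_two]

lemma exists_aeval_shear_eq (α : ℂ) (z z' : K) {p : MvPolynomial (Fin 2) ℂ} (hp : p ≠ 0) :
    ∃ q : MvPolynomial (Fin 2) ℂ, q ≠ 0 ∧
      MvPolynomial.aeval ![z + scalarIn K α * z', z'] p = MvPolynomial.aeval ![z, z'] q := by
  open MvPolynomial in
  let σ : MvPolynomial (Fin 2) ℂ →ₐ[ℂ] MvPolynomial (Fin 2) ℂ := aeval ![X 0 + C α * X 1, X 1]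
  open MvPolynomial in
  let τ : MvPolynomial (Fin 2) ℂ →ₐ[ℂ] MvPolynomial (Fin 2) ℂ := aeval ![X 0 - C α * X 1, X 1]
  have hτσ : τ.comp σ = AlgHom.id ℂ _ := by
    ext i
    fin_cases i <;> simp [σ, τ, ← MvPolynomial.algebraMap_eq]
  have hσ : MvPolynomial.aeval ![z + scalarIn K α * z', z'] =
      (MvPolynomial.aeval ![z, z']).comp σ := by
    ext i
    fin_cases i <;> simp [σ, ← MvPolynomial.algebraMap_eq]
  refine ⟨σ p, fun h => hp ?_, DFunLike.congr_fun hσ p⟩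
  have := DFunLike.congr_fun hτσ p
  rw [AlgHom.comp_apply, h, map_zero] at this
  exact this.symm

end AbstractModule

/-- `iterCoeff` as an additive homomorphism. -/
def iterCoeffHom : IterLaurent W →+ (ℤ → ℤ → W) where
  toFun := iterCoeff
  map_zero' := rfl
  map_add' _ _ := rfl

lemma iterCoeff_scalarIn_smul (c : ℂ) (v : IterLaurent W) :
    iterCoeff (scalarIn K2 c • v) = c • iterCoeff v := by
  funext j t
  have := iterCoeff_single_smul 0 0 c v j t
  rw [sub_zero, sub_zero, ← scalarIn_K2] at this
  exact this

/-- Scalar multiplication by `p(x₀ + αx, x)` in terms of coefficients. -/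
lemma iterCoeff_qK_smul (p : MvPolynomial (Fin 2) ℂ) (α : ℂ) (v : IterLaurent W) :
    iterCoeff (qK p α • v) = mulSubPolyA α p (iterCoeff v) := by
  rw [mulSubPolyA_eq_evalEnd]
  have hc : ∀ (c : ℂ) (v : IterLaurent W),
      iterCoeffHom (scalarIn K2 c • v) = c • iterCoeffHom v := iterCoeff_scalarIn_smul
  refine map_aeval_smul iterCoeffHom hc (fun v => ?_) iterCoeff_xInner_smul p v
  have h : (xOuter + xInnerC α) • v = xOuter • v + xInnerC α • v :=
    add_smul (R := K2) (M := IterLaurent W) _ _ _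
  refine (congrArg iterCoeff h).trans ?_
  rw [iterCoeff_add, iterCoeff_xOuter_smul, iterCoeff_xInnerC_smul]
  rfl

lemma xOuter_pow_mul_xInner_pow (m n : ℕ) : xOuter ^ m * xInner ^ n =
    (HahnSeries.single (m : ℤ) (HahnSeries.single (n : ℤ) (1 : ℂ) : LC) : K2) := by
  simp [xOuter, xInner, HahnSeries.single_pow, HahnSeries.single_mul_single]

lemma aeval_xOuter_xInner_coeff (p : MvPolynomial (Fin 2) ℂ) (d : Fin 2 →₀ ℕ) :
    ((MvPolynomial.aeval ![xOuter, xInner] p : K2).coeff (d 0)).coeff (d 1) = p.coeff d := by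
  have hterm : ∀ e : Fin 2 →₀ ℕ,
      scalarIn K2 (p.coeff e) * (xOuter ^ e 0 * xInner ^ e 1) =
      HahnSeries.single (e 0 : ℤ) (HahnSeries.single (e 1 : ℤ) (p.coeff e) : LC) := by
    intro e
    rw [scalarIn_K2, xOuter_pow_mul_xInner_pow]
    simp [HahnSeries.single_mul_single]
  have h : (MvPolynomial.aeval ![xOuter, xInner] p : K2) = ∑ e ∈ p.support,
      (HahnSeries.single (e 0 : ℤ) (HahnSeries.single (e 1 : ℤ) (p.coeff e) : LC) : K2) :=
    (aeval_eq_sum xOuter xInner p).trans (Finset.sum_congr rfl fun e _ => hterm e)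
  rw [h]
  simp only [HahnSeries.coeff_sum]
  rw [Finset.sum_eq_single d]
  · simp
  · intro e _ he
    by_cases h0 : e 0 = d 0
    · have h1 : e 1 ≠ d 1 := fun h1 => he (by ext i; fin_cases i <;> simp [h0, h1])
      rw [h0, HahnSeries.coeff_single_same,
        HahnSeries.coeff_single_of_ne (by exact_mod_cast h1.symm)]
    · rw [HahnSeries.coeff_single_of_ne (by exact_mod_cast (Ne.symm h0)), HahnSeries.coeff_zero]
  · intro hd
    simp [MvPolynomial.notMem_support_iff.mp hd]

lemma qK_ne_zero {p : MvPolynomial (Fin 2) ℂ} (hp : p ≠ 0) (α : ℂ) : qK p α ≠ 0 := by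
  obtain ⟨q, hq, e⟩ := exists_aeval_shear_eq α xOuter xInner hp
  have hα : xInnerC α = scalarIn K2 α * xInner := by
    rw [scalarIn_K2]
    simp [xInnerC, xInner, HahnSeries.single_mul_single]
  obtain ⟨d, hd⟩ := MvPolynomial.ne_zero_iff.mp hq
  intro h
  apply hd
  rw [← aeval_xOuter_xInner_coeff, ← e, ← hα]
  refine (congrArg (fun u : K2 => (u.coeff (d 0)).coeff (d 1)) h).trans ?_
  simp
lemma finite_setOf_coeff_ne_zero {R V : Type*} [Zero R] [Zero V] (x : HahnSeries ℤ R)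
    (y : HahnSeries ℤ V) (a : ℤ) : {s | x.coeff s ≠ 0 ∧ y.coeff (a - s) ≠ 0}.Finite := by
  refine ((Set.VAddAntidiagonal.finite_of_isPWO x.isPWO_support y.isPWO_support a).image
    Prod.fst).subset fun s hs => ⟨(s, a - s), ⟨hs.1, hs.2, ?_⟩, rfl⟩
  simp

lemma coeff_smul_eq_finsum {R V : Type*} [MulZeroClass R] [AddCommMonoid V] [SMulWithZero R V]
    (x : HahnSeries ℤ R) (y : HahnModule ℤ R V) (a : ℤ) :
    ((HahnModule.of R).symm (x • y)).coeff a =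
      ∑ᶠ s, x.coeff s • ((HahnModule.of R).symm y).coeff (a - s) := by
  rw [HahnModule.coeff_smul]
  have hinj : Set.InjOn Prod.fst
      ((Finset.VAddAntidiagonal a (Set.VAddAntidiagonal.finite_of_isPWO x.isPWO_support
        ((HahnModule.of R).symm y).isPWO_support a) : Finset (ℤ × ℤ)) : Set (ℤ × ℤ)) := by
    intro u hu u' hu' h
    simp only [Finset.mem_coe, Finset.mem_vaddAntidiagonal, vadd_eq_add] at hu hu'
    exact Prod.ext h (by omega)
  rw [finsum_eq_sum_of_support_subset (s := (Finset.VAddAntidiagonal a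
    (Set.VAddAntidiagonal.finite_of_isPWO x.isPWO_support
      ((HahnModule.of R).symm y).isPWO_support a)).image Prod.fst), Finset.sum_image hinj]
  · refine Finset.sum_congr rfl fun u hu => ?_
    simp only [Finset.mem_vaddAntidiagonal, vadd_eq_add] at hu
    rw [← hu.2.2, add_sub_cancel_left]
  · intro s hs
    simp only [Finset.coe_image, Set.mem_image, Finset.mem_coe, Finset.mem_vaddAntidiagonal,
      HahnSeries.mem_support, vadd_eq_add]
    refine ⟨(s, a - s), ⟨fun h => hs ?_, fun h => hs ?_, by simp⟩, rfl⟩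
    · simp only [h, zero_smul]
    · simp only [h, smul_zero]

/-- The coefficient of `x₀^j x^t`, as an additive map on `W((x))` for fixed `t`. -/
def coeffHom (t : ℤ) : HahnModule ℤ ℂ W →+ W where
  toFun y := ((HahnModule.of ℂ).symm y).coeff t
  map_zero' := rfl
  map_add' _ _ := rfl

lemma iterCoeff_smul (x : K2) (v : IterLaurent W) (J T : ℤ) :
    iterCoeff (x • v) J T =
      ∑ᶠ s : ℤ × ℤ, (x.coeff s.1).coeff s.2 • iterCoeff v (J - s.1) (T - s.2) := by
  let y : ℤ → HahnModule ℤ ℂ W := ((HahnModule.of LC).symm v).coeff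
  have hA : {s | x.coeff s ≠ 0 ∧ y (J - s) ≠ 0}.Finite :=
    finite_setOf_coeff_ne_zero x ((HahnModule.of LC).symm v) J
  have hB := fun s₁ => finite_setOf_coeff_ne_zero (x.coeff s₁)
    ((HahnModule.of ℂ).symm (y (J - s₁))) T
  rw [finsum_curry]
  · have h : iterCoeff (x • v) J T = coeffHom T (∑ᶠ s, x.coeff s • y (J - s)) :=
      congrArg (coeffHom T) (coeff_smul_eq_finsum x
        (v : HahnModule ℤ LC (HahnModule ℤ ℂ W)) J)
    rw [h, AddMonoidHom.map_finsum]
    · exact finsum_congr fun s₁ => coeff_smul_eq_finsum (x.coeff s₁) (y (J - s₁)) T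
    · refine hA.subset fun s hs => ⟨fun h => hs ?_, fun h => hs ?_⟩
      · exact (congrArg (· • y (J - s)) h).trans (zero_smul LC (y (J - s)))
      · simp only [h, smul_zero]
  · refine (hA.biUnion fun s₁ _ => (hB s₁).image (Prod.mk s₁)).subset fun s hs => ?_
    have h₁ : (x.coeff s.1).coeff s.2 ≠ 0 := fun h => hs (by simp only [h, zero_smul])
    have h₂ : iterCoeff v (J - s.1) (T - s.2) ≠ 0 := fun h => hs (by simp only [h, smul_zero])
    refine Set.mem_biUnion (x := s.1) ⟨fun h => h₁ ?_, fun h => h₂ ?_⟩ ⟨s.2, ⟨h₁, h₂⟩, rfl⟩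
    · rw [h, HahnSeries.coeff_zero]
    · exact congrArg (coeffHom (T - s.2)) h

/-! ### The vertex operation as an element of `W((x))((x₀))` -/

lemma substFamily_binomZ_of_neg (α : ℂ) (G : ℤ → ℤ → W) {j : ℤ} (hj : j < 0) (t : ℤ) :
    substFamily α binomZ G j t = 0 := by
  simp only [substFamily, binomZ_of_neg _ hj, zero_mul, zero_smul, finsum_zero]

lemma IsLaurent2.exists_iterCoeff_eq {G : ℤ → ℤ → W} (hG : IsLaurent2 G) (α : ℂ) :
    ∃ v : IterLaurent W, iterCoeff v = substFamily α binomZ G := by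
  obtain ⟨N, hN⟩ := hG
  refine NVA.exists_iterCoeff_eq _ ⟨0, fun j hj => substFamily_binomZ_of_neg α G hj⟩
    fun j => ⟨2 * N - j, fun t ht => ?_⟩
  refine (finsum_congr fun m => ?_).trans finsum_zero
  rw [hN m (t - m + j) (by omega), smul_zero]

lemma fullYE_eq_finsum (α : ℂ) (p : MvPolynomial (Fin 2) ℂ) (a b : EW W) (w : W) (J T : ℤ) :
    fullYE α p a b w J T = ∑ᶠ s : ℤ × ℤ, ((qInv p α).coeff s.1).coeff s.2 •
      substFamily α binomZ (mulPoly p (Fab a b w)) (J - s.1) (T - s.2) := by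
  refine finsum_congr fun s => ?_
  rcases lt_or_ge (J - s.1) 0 with h | h
  · rw [if_neg (not_le.mpr h), substFamily_binomZ_of_neg α _ h]
  · obtain ⟨j, hj⟩ := Int.eq_ofNat_of_zero_le h
    rw [if_pos h, hj]
    simp only [substYE, substFamily, binomZ_natCast, Int.toNat_natCast]

lemma mulSubPolyA_mulPoly_comm {α : ℂ} (hα : α ≠ 0) {p q : MvPolynomial (Fin 2) ℂ}
    {F : ℤ → ℤ → W} (hp : IsLaurent2 (mulPoly p F)) (hq : IsLaurent2 (mulPoly q F)) :
    mulSubPolyA α q (substFamily α binomZ (mulPoly p F)) =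
      mulSubPolyA α p (substFamily α binomZ (mulPoly q F)) := by
  rw [← substFamily_mulPoly hα binomZ_succ q (hp.mem_substDomain _),
    ← substFamily_mulPoly hα binomZ_succ p (hq.mem_substDomain _), mulPoly_comm]

lemma smul_inv_smul_of_smul_eq {K M : Type*} [Field K] [AddCommGroup M] [Module K M] {x z : K}
    (hx : x ≠ 0) {u v : M} (h : z • v = x • u) : z • x⁻¹ • v = u := by
  rw [smul_comm, h, inv_smul_smul₀ hx]

lemma smul_qInv_smul {p q : MvPolynomial (Fin 2) ℂ} (hp : p ≠ 0) {α : ℂ} {u v : IterLaurent W}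
    (h : qK q α • v = qK p α • u) : qK q α • qInv p α • v = u :=
  smul_inv_smul_of_smul_eq (K := K2) (M := IterLaurent W) (qK_ne_zero hp α) h

lemma qK_smul_left_cancel {p : MvPolynomial (Fin 2) ℂ} (hp : p ≠ 0) {α : ℂ}
    {u v : IterLaurent W} (h : qK p α • u = qK p α • v) : u = v :=
  (smul_qInv_smul hp rfl).symm.trans (smul_qInv_smul hp h)

/-- For `y` with coefficients `fullYE`, multiplication by `q(x₀ + αx, x)` gives
`(q(x₁, x)a(x₁)b(x)w)|_{x₁ = αx + x₀}`. -/
lemma exists_vertex {α : ℂ} (hα : α ≠ 0) {p : MvPolynomial (Fin 2) ℂ} (hp : p ≠ 0)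
    {a b : EW W} {w : W} (h : IsLaurent2 (mulPoly p (Fab a b w))) :
    ∃ y : IterLaurent W, iterCoeff y = fullYE α p a b w ∧
      ∀ q, IsLaurent2 (mulPoly q (Fab a b w)) →
        iterCoeff (qK q α • y) = substFamily α binomZ (mulPoly q (Fab a b w)) := by
  obtain ⟨v, hv⟩ := h.exists_iterCoeff_eq α
  refine ⟨qInv p α • v, ?_, fun q hq => ?_⟩
  · funext J T
    rw [iterCoeff_smul, fullYE_eq_finsum, hv]
  · obtain ⟨u, hu⟩ := hq.exists_iterCoeff_eq α
    have hpq : qK q α • v = qK p α • u := by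
      apply iterCoeff_injective
      rw [iterCoeff_qK_smul, iterCoeff_qK_smul, hv, hu, mulSubPolyA_mulPoly_comm hα h hq]
    rw [smul_qInv_smul hp hpq, hu]

/-- The coefficients `fullYE` do not depend on the choice of the polynomial. -/
lemma fullYE_eq_fullYE {α : ℂ} (hα : α ≠ 0) {p q : MvPolynomial (Fin 2) ℂ} (hp : p ≠ 0)
    (hq : q ≠ 0) {a b : EW W} {w : W} (hpF : IsLaurent2 (mulPoly p (Fab a b w)))
    (hqF : IsLaurent2 (mulPoly q (Fab a b w))) :
    fullYE α p a b w = fullYE α q a b w := by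
  obtain ⟨y, hy, hy'⟩ := exists_vertex hα hp hpF
  obtain ⟨z, hz, hz'⟩ := exists_vertex hα hq hqF
  have h : qK q α • y = qK q α • z := iterCoeff_injective ((hy' q hqF).trans (hz' q hqF).symm)
  have e : y = z := qK_smul_left_cancel hq h
  rw [← hy, ← hz, e]

lemma fullYE_add {α : ℂ} (hα : α ≠ 0) {p : MvPolynomial (Fin 2) ℂ} (hp : p ≠ 0) {a b : EW W}
    (h : ∀ w, IsLaurent2 (mulPoly p (Fab a b w))) (w w' : W) :
    fullYE α p a b (w + w') = fullYE α p a b w + fullYE α p a b w' := by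
  obtain ⟨y, hy, hy'⟩ := exists_vertex hα hp (h w)
  obtain ⟨z, hz, hz'⟩ := exists_vertex hα hp (h w')
  obtain ⟨u, hu, hu'⟩ := exists_vertex hα hp (h (w + w'))
  have hadd : qK p α • u = qK p α • (y + z) := by
    apply iterCoeff_injective
    have e : qK p α • (y + z) = qK p α • y + qK p α • z :=
      smul_add (M := K2) (A := IterLaurent W) _ _ _
    rw [e, iterCoeff_add, hu' p (h _), hy' p (h _), hz' p (h _), Fab_add,
      mulPoly_eq_evalEnd, map_add, ← mulPoly_eq_evalEnd, ← mulPoly_eq_evalEnd]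
    exact (substLinear α binomZ).map_add ⟨_, (h w).mem_substDomain _⟩
      ⟨_, (h w').mem_substDomain _⟩
  have e : u = y + z := qK_smul_left_cancel hp hadd
  rw [← hy, ← hz, ← hu, e, iterCoeff_add]

lemma fullYE_smul (α : ℂ) (p : MvPolynomial (Fin 2) ℂ) (a b : EW W) (c : ℂ) (w : W) (J T : ℤ) :
    fullYE α p a b (c • w) J T = c • fullYE α p a b w J T := by
  simp only [fullYE_eq_finsum, Fab_smul, mulPoly_eq_evalEnd, map_smul, substFamily,
    Pi.smul_apply, smul_finsum]
  refine finsum_congr fun s => finsum_congr fun m => ?_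
  simp only [smul_smul]
  congr 1
  ring

lemma rawYE_eq {α : ℂ} (hα : α ≠ 0) {p : MvPolynomial (Fin 2) ℂ} (hp : p ≠ 0) {a b : EW W}
    (h : ∀ w, IsLaurent2 (mulPoly p (Fab a b w))) (n : ℤ) (w : W) (m : ℤ) :
    rawYE α a b n w m = fullYE α p a b w (-n - 1) (-m - 1) := by
  have hq : QCPair a b := ⟨p, hp, h⟩
  rw [rawYE, dif_pos hq,
    fullYE_eq_fullYE hα hq.choose_spec.1 hp (hq.choose_spec.2 w) (h w)]

lemma mf_YEa {a b : EW W} (α : ℂˣ) (h : QCPair a b) (n : ℤ) (w : W) (m : ℤ) :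
    mf (YEa α a b n) w m = rawYE (α : ℂ) a b n w m := by
  obtain ⟨p, hp, hF⟩ := h
  have hc : ∃ c : EW W, ∀ w m, mf c w m = rawYE (α : ℂ) a b n w m := by
    simp only [rawYE_eq α.ne_zero hp hF]
    refine ⟨⟨⟨⟨fun w m => fullYE α p a b w (-n - 1) (-m - 1), fun w w' => ?_⟩, fun c w => ?_⟩,
      fun w => ?_⟩, fun _ _ => rfl⟩
    · rw [fullYE_add α.ne_zero hp hF]
      rfl
    · funext m
      exact fullYE_smul _ p a b c w _ _
    · obtain ⟨y, hy, -⟩ := exists_vertex α.ne_zero hp (hF w)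
      obtain ⟨N, hN⟩ := iterCoeff_lt y (-n - 1)
      refine ⟨-N, fun m hm => ?_⟩
      change fullYE α p a b w (-n - 1) (-m - 1) = 0
      rw [← hy]
      exact hN _ (by omega)
  rw [YEa, dif_pos hc]
  exact hc.choose_spec w m

/-- cf. Proposition 2.8.  Let `(a(x), b(x))` be a quasi compatible
pair in `ℰ(W)` and `α ∈ ℂˣ`.  Then:
(1) each `a(x)_{(α,n)} b(x)` is a well-defined element of `ℰ(W)`, whose modes are
given by the defining expansion;
(2) if `p(x₁,x₂)` is a nonzero polynomial with
`p(x₁,x₂)a(x₁)b(x₂) ∈ Hom(W,W((x₁,x₂)))` and `k ∈ ℤ` is such that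
`x₀^k ι_{x₂,x₀}(p(x₀+αx₂,x₂)⁻¹) ∈ ℂ((x₂))[[x₀]]`, then `a(x)_{(α,n)} b(x) = 0` for
`n ≥ k`;
(3) for `w ∈ W` and `l ∈ ℕ` with `x₁^l p(x₁,x₂) a(x₁) b(x₂) w ∈ W[[x₁,x₂]][x₂⁻¹]`,
`(x₀+αx₂)^l p(x₀+αx₂,x₂) (Y_ℰ^{(α)}(a(x₂),x₀)b(x₂))w
  = (x₀+αx₂)^l p(x₀+αx₂,x₂) a(x₀+αx₂) b(x₂) w`. -/
theorem statement3 {W : Type*} [AddCommGroup W] [Module ℂ W]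
    (a b : EW W) (α : ℂˣ) (h : QCPair a b) :
    (∀ (n : ℤ) (w : W) (m : ℤ), mf (YEa α a b n) w m = rawYE (α : ℂ) a b n w m) ∧
    (∀ p : MvPolynomial (Fin 2) ℂ, p ≠ 0 →
      (∀ w, IsLaurent2 (mulPoly p (Fab a b w))) →
      ∀ k : ℤ, (∀ j : ℤ, j < -k → (qInv p (α : ℂ)).coeff j = 0) →
      ∀ n : ℤ, k ≤ n → YEa α a b n = 0) ∧
    (∀ p : MvPolynomial (Fin 2) ℂ, p ≠ 0 →
      (∀ w, IsLaurent2 (mulPoly p (Fab a b w))) →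
      ∀ (w : W) (l : ℕ),
        (∃ N : ℤ, ∀ m t : ℤ, (m < 0 ∨ t < N) →
          mulPoly (MvPolynomial.X 0 ^ l * p) (Fab a b w) m t = 0) →
        ∀ J T : ℤ,
          mulSubPolyA (α : ℂ) (MvPolynomial.X 0 ^ l * p)
            (fun j t => mf (YEa α a b (-j - 1)) w (-t - 1)) J T =
          mulSubPolyA (α : ℂ) (MvPolynomial.X 0 ^ l * p) (substExp (α : ℂ) a b w) J T) := by
  refine ⟨mf_YEa α h, fun p hp hF k hk n hn => ?_, fun p hp hF w l hl J T => ?_⟩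
  · refine Subtype.ext (LinearMap.ext fun w => funext fun m => ?_)
    refine (mf_YEa α h n w m).trans ?_
    rw [rawYE_eq α.ne_zero hp hF, fullYE_eq_finsum]
    refine (finsum_congr fun s => ?_).trans finsum_zero
    rcases lt_or_ge (-n - 1 - s.1) 0 with hs | hs
    · rw [substFamily_binomZ_of_neg _ _ hs, smul_zero]
    · rw [hk s.1 (by omega), HahnSeries.coeff_zero, zero_smul]
  · obtain ⟨y, hy, hy'⟩ := exists_vertex α.ne_zero hp (hF w)
    have hfam : (fun j t => mf (YEa α a b (-j - 1)) w (-t - 1)) = iterCoeff y := by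
      funext j t
      rw [mf_YEa α h, rawYE_eq α.ne_zero hp hF, hy]
      congr 1 <;> ring
    have hlaurent : IsLaurent2 (mulPoly (MvPolynomial.X 0 ^ l * p) (Fab a b w)) := by
      obtain ⟨N, hN⟩ := hl
      exact ⟨min 0 N, fun m t hmt => hN m t (by omega)⟩
    have hsymm := substFamily_binomZ_symm (α : ℂ)
      (G := mulPoly (MvPolynomial.X 0 ^ l * p) (Fab a b w)) fun m t hm => by
        obtain ⟨N, hN⟩ := hl
        exact hN m t (Or.inl hm)
    have hpascal : ∀ m j : ℤ, binomZ (m + 1) (m + 1 - j) =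
        binomZ m (m - j) + binomZ m (m - (j - 1)) := by
      intro m j
      rw [binomZ_succ, add_comm]
      congr 2 <;> ring
    rw [hfam, ← iterCoeff_qK_smul, hy' _ hlaurent, substExp_eq_substFamily,
      ← substFamily_mulPoly α.ne_zero hpascal _ (Fab_mem_substDomain a b w), hsymm]

end NVA
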